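/- Let 𝒜 = {A₁, …, A_m} ⊆ ℝ^{n×n} and let ℓ be a positive integer. If limsup_{k→∞} (max_{σ ∈ {1,…,m}ᵏ} ‖A_{σ_k} ⋯ A_{σ_1}‖)^{1/k} < 1/n^{1/(2ℓ)} (i.e., the joint spectral radius of 𝒜 is less than n^{-1/(2ℓ)}), then there exists a contracting GE-d-norm for 𝒜 with d ≤ max{2m^{ℓ-1} - 3, 0}; i.e., there is a symmetric n×n univariate polynomial matrix P(t) of degree at most max{2m^{ℓ-1} - 3, 0} satisfying P(t) ⪰ 0 for all t ∈ [-1,1] and ⋂_{t∈[-1,1]} Ker(P(t)) = {0}, such that V(x) = max_{t∈[-1,1]} √(xᵀP(t)x) satisfies V(Aᵢ x) < V(x) for all x ≠ 0 and all i = 1,…,m. -/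

import Mathlib

open Matrix Polynomial

/-- The ℓ₂→ℓ₂ operator norm of a real square matrix. -/
noncomputable def opNorm {n : ℕ} (A : Matrix (Fin n) (Fin n) ℝ) : ℝ :=
  ‖(Matrix.toEuclideanCLM (𝕜 := ℝ) A :
      EuclideanSpace ℝ (Fin n) →L[ℝ] EuclideanSpace ℝ (Fin n))‖

/-- The generalized ellipsoid norm `V(x) = max_{t ∈ [-1,1]} √(xᵀ P(t) x)`. -/
noncomputable def geNorm {n : ℕ} (P : Matrix (Fin n) (Fin n) (Polynomial ℝ))
    (x : Fin n → ℝ) : ℝ :=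
  ⨆ t : Set.Icc (-1 : ℝ) 1, Real.sqrt (x ⬝ᵥ (P.map (Polynomial.eval t.1)).mulVec x)


lemma sum_cos_zero (L : ℕ) (hL : 0 < L) (a : ℤ) (ha : a ≠ 0) (h1 : -(L:ℤ) < a) (h2 : a < L) :
    ∑ k ∈ Finset.range L, Real.cos ((a:ℝ) * (2 * Real.pi * k / L)) = 0 := by
  have hLc : (L:ℂ) ≠ 0 := by exact_mod_cast hL.ne'
  have hpi : (2 * (Real.pi:ℂ) * Complex.I) ≠ 0 := Complex.two_pi_I_ne_zero
  set z : ℂ := Complex.exp ((a:ℂ) * (2 * Real.pi * Complex.I) / L) with hz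
  have hz1 : z ≠ 1 := by
    intro h
    rw [hz, Complex.exp_eq_one_iff] at h
    obtain ⟨q, hq⟩ := h
    have : (a:ℂ) = q * L := by
      field_simp at hq
      linear_combination hq
    have h3 : a = q * L := by exact_mod_cast this
    have hq0 : q ≠ 0 := by rintro rfl; simp at h3; exact ha h3
    rcases lt_or_gt_of_ne hq0 with h | h
    · nlinarith
    · nlinarith
  have hzL : z ^ L = 1 := by
    rw [hz, ← Complex.exp_nat_mul, Complex.exp_eq_one_iff]
    exact ⟨a, by field_simp⟩
  have hs : ∑ k ∈ Finset.range L, z ^ k = 0 := by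
    have := mul_neg_geom_sum z L
    rw [hzL, sub_self] at this
    rcases mul_eq_zero.mp this with h | h
    · exact absurd (sub_eq_zero.mp h).symm hz1
    · exact h
  have := congrArg Complex.re hs
  rw [Complex.re_sum] at this
  rw [← Complex.zero_re, ← this]
  refine Finset.sum_congr rfl fun k _ => ?_
  rw [hz, ← Complex.exp_nat_mul]
  have : (k:ℂ) * ((a:ℂ) * (2 * Real.pi * Complex.I) / L)
      = (((a:ℝ) * (2 * Real.pi * k / L) : ℝ) : ℂ) * Complex.I := by
    push_cast; ring
  rw [this, Complex.exp_ofReal_mul_I_re]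

/-- Fejér kernel -/
noncomputable def fk (L : ℕ) (θ : ℝ) : ℝ :=
  (∑ j ∈ Finset.range L, ∑ j' ∈ Finset.range L, Real.cos ((((j:ℤ) - (j':ℤ) : ℤ) : ℝ) * θ)) / (L:ℝ)^2

lemma fk_nonneg (L : ℕ) (θ : ℝ) : 0 ≤ fk L θ := by
  unfold fk
  apply div_nonneg _ (by positivity)
  have : ∑ j ∈ Finset.range L, ∑ j' ∈ Finset.range L, Real.cos ((((j:ℤ) - (j':ℤ) : ℤ) : ℝ) * θ)
    = (∑ j ∈ Finset.range L, Real.cos (j * θ))^2 + (∑ j ∈ Finset.range L, Real.sin (j * θ))^2 := by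
    rw [sq, sq, Finset.sum_mul_sum, Finset.sum_mul_sum, ← Finset.sum_add_distrib]
    refine Finset.sum_congr rfl fun j _ => ?_
    rw [← Finset.sum_add_distrib]
    refine Finset.sum_congr rfl fun j' _ => ?_
    push_cast
    rw [sub_mul, Real.cos_sub]
  rw [this]; positivity

lemma fk_zero (L : ℕ) (hL : 0 < L) : fk L 0 = 1 := by
  have : (L:ℝ) ≠ 0 := by exact_mod_cast hL.ne'
  simp [fk]; field_simp

lemma fk_two_pi (L : ℕ) (hL : 0 < L) : fk L (2 * Real.pi) = 1 := by
  have : (L:ℝ) ≠ 0 := by exact_mod_cast hL.ne'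
  simp only [fk, Real.cos_int_mul_two_pi]
  simp; field_simp

noncomputable def vk (L k : ℕ) : ℝ[X] :=
  C (1 / (L:ℝ)^2) * ∑ j ∈ Finset.range L, ∑ j' ∈ Finset.range L,
    C (Real.cos ((((j:ℤ) - (j':ℤ) : ℤ) : ℝ) * (2 * Real.pi * k / L))) *
      Chebyshev.T ℝ ((j:ℤ) - (j':ℤ))

lemma vk_deg (L k : ℕ) : (vk L k).natDegree ≤ L - 1 := by
  unfold vk
  refine (natDegree_C_mul_le _ _).trans ?_
  refine natDegree_sum_le_of_forall_le _ _ fun j hj => ?_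
  refine natDegree_sum_le_of_forall_le _ _ fun j' hj' => ?_
  refine (natDegree_C_mul_le _ _).trans ?_
  rw [Chebyshev.natDegree_T]
  simp at hj hj'
  omega

lemma vk_eval (L k : ℕ) (θ : ℝ) : (vk L k).eval (Real.cos θ) =
    (fk L (θ - 2 * Real.pi * k / L) + fk L (θ + 2 * Real.pi * k / L)) / 2 := by
  unfold vk fk
  simp only [eval_mul, eval_C, eval_finsetSum, Chebyshev.T_real_cos]
  rw [← add_div, ← Finset.sum_add_distrib]
  simp_rw [← Finset.sum_add_distrib]
  rw [div_div, mul_comm _ (2:ℝ), ← div_div, Finset.sum_div, mul_comm, mul_one_div]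
  congr 1
  refine Finset.sum_congr rfl fun j _ => ?_
  rw [Finset.sum_div]
  refine Finset.sum_congr rfl fun j' _ => ?_
  rw [mul_sub, mul_add, Real.cos_sub, Real.cos_add]
  ring

lemma vk_nonneg (L k : ℕ) (t : ℝ) (ht : t ∈ Set.Icc (-1:ℝ) 1) : 0 ≤ (vk L k).eval t := by
  rw [← Real.cos_arccos ht.1 ht.2, vk_eval]
  have := fk_nonneg L (Real.arccos t - 2 * Real.pi * k / L)
  have := fk_nonneg L (Real.arccos t + 2 * Real.pi * k / L)
  linarith

lemma vk_sum (L : ℕ) (hL : 0 < L) (t : ℝ) : ∑ k ∈ Finset.range L, (vk L k).eval t = 1 := by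
  have hL' : (L:ℝ) ≠ 0 := by exact_mod_cast hL.ne'
  unfold vk
  simp only [eval_mul, eval_C, eval_finsetSum]
  rw [← Finset.mul_sum, Finset.sum_comm]
  have : ∀ j ∈ Finset.range L, ∑ k ∈ Finset.range L, ∑ j' ∈ Finset.range L,
    Real.cos ((((j:ℤ) - (j':ℤ) : ℤ) : ℝ) * (2 * Real.pi * k / L)) *
      (Chebyshev.T ℝ ((j:ℤ) - (j':ℤ))).eval t = L := by
    intro j hj
    rw [Finset.sum_comm]
    simp_rw [← Finset.sum_mul]
    rw [Finset.sum_eq_single j]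
    · simp
    · intro j' hj' hne
      simp at hj hj'
      rw [sum_cos_zero L hL _ (by omega) (by omega) (by omega), zero_mul]
    · intro h; exact absurd hj h
  rw [Finset.sum_congr rfl this]
  simp; field_simp

lemma interp (N : ℕ) (hN : 0 < N) : ∃ u : Fin N → ℝ[X], (∀ i, (u i).natDegree ≤ 2 * N - 3) ∧
    (∀ i, ∀ t ∈ Set.Icc (-1:ℝ) 1, 0 ≤ (u i).eval t) ∧
    (∀ t : ℝ, ∑ i, (u i).eval t = 1) ∧
    ∀ i, ∃ t ∈ Set.Icc (-1:ℝ) 1, 1 ≤ (u i).eval t := by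
  obtain rfl | ⟨M, hM, rfl⟩ : N = 1 ∨ ∃ M, 0 < M ∧ N = M + 1 := by
    rcases N with _ | _ | M
    · omega
    · left; rfl
    · right; exact ⟨M+1, by omega, rfl⟩
  · exact ⟨fun _ => 1, by simp, by simp, by simp, fun i => ⟨0, by simp, by simp⟩⟩
  have hL : 0 < 2 * M := by omega
  have hMr : (M:ℝ) ≠ 0 := by exact_mod_cast hM.ne'
  refine ⟨fun i => ∑ k ∈ (Finset.range (2*M)).filter (fun k => min k (2*M-k) = i.1), vk (2*M) k,
    ?_, ?_, ?_, ?_⟩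
  · intro i
    refine natDegree_sum_le_of_forall_le _ _ fun k _ => (vk_deg _ _).trans (by omega)
  · intro i t ht
    rw [eval_finsetSum]
    exact Finset.sum_nonneg fun k _ => vk_nonneg _ _ _ ht
  · intro t
    simp only [eval_finsetSum]
    rw [← vk_sum (2*M) hL t,
      Fin.sum_univ_eq_sum_range (fun i => ∑ k ∈ (Finset.range (2*M)).filter
        (fun k => min k (2*M-k) = i), (vk (2*M) k).eval t)]
    refine Finset.sum_fiberwise_of_maps_to (fun k hk => ?_) _
    simp at hk ⊢; omega
  · intro i
    refine ⟨Real.cos (2 * Real.pi * i.1 / (2*M:ℕ)), ⟨Real.neg_one_le_cos _, Real.cos_le_one _⟩, ?_⟩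
    set t := Real.cos (2 * Real.pi * i.1 / (2*M:ℕ)) with ht
    have htI : t ∈ Set.Icc (-1:ℝ) 1 := ⟨Real.neg_one_le_cos _, Real.cos_le_one _⟩
    rw [eval_finsetSum]
    have hi := i.2
    have hnn : ∀ k, 0 ≤ (vk (2*M) k).eval t := fun k => vk_nonneg _ _ _ htI
    have e1 : (vk (2*M) i.1).eval t = (1 + fk (2*M) (2 * Real.pi * i.1 / (2*M:ℕ) + 2 * Real.pi * i.1 / (2*M:ℕ)))/2 := by
      rw [ht, vk_eval, sub_self, fk_zero _ hL]
    by_cases hc : i.1 = 0 ∨ i.1 = M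
    · have h1 : (vk (2*M) i.1).eval t = 1 := by
        rcases hc with h | h
        · rw [e1, h]; simp [fk_zero _ hL]
        · rw [e1, h]
          have : 2 * Real.pi * M / (2*M:ℕ) + 2 * Real.pi * M / (2*M:ℕ) = 2 * Real.pi := by
            push_cast; field_simp; ring
          rw [this, fk_two_pi _ hL]; norm_num
      rw [← h1]
      refine Finset.single_le_sum (f := fun k => (vk (2*M) k).eval t) (fun k _ => hnn k) ?_
      simp; omega
    · push Not at hc
      have h1 : 1/2 ≤ (vk (2*M) i.1).eval t := by
        rw [e1]
        have := fk_nonneg (2*M) (2 * Real.pi * i.1 / (2*M:ℕ) + 2 * Real.pi * i.1 / (2*M:ℕ))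
        linarith
      have h2 : 1/2 ≤ (vk (2*M) (2*M-i.1)).eval t := by
        rw [ht, vk_eval]
        have : 2 * Real.pi * i.1 / (2*M:ℕ) + 2 * Real.pi * (2*M-i.1:ℕ) / (2*M:ℕ) = 2 * Real.pi := by
          rw [Nat.cast_sub (by omega)]
          push_cast; field_simp; ring
        rw [this, fk_two_pi _ hL]
        have := fk_nonneg (2*M) (2 * Real.pi * i.1 / (2*M:ℕ) - 2 * Real.pi * (2*M-i.1:ℕ) / (2*M:ℕ))
        linarith
      have hne : i.1 ≠ 2*M-i.1 := by omega
      calc (1:ℝ) ≤ ∑ k ∈ {i.1, 2*M-i.1}, (vk (2*M) k).eval t := by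
            rw [Finset.sum_pair hne]; linarith
        _ ≤ _ := by
            refine Finset.sum_le_sum_of_subset_of_nonneg ?_ fun k _ _ => hnn k
            intro k hk
            simp at hk ⊢
            omega


lemma quad_smul_add {n : ℕ} (Q R : Matrix (Fin n) (Fin n) ℝ) (a b : ℝ) (x : Fin n → ℝ) :
    x ⬝ᵥ (a • Q + b • R) *ᵥ x = a * (x ⬝ᵥ Q *ᵥ x) + b * (x ⬝ᵥ R *ᵥ x) := by
  simp [add_mulVec, smul_mulVec, dotProduct_add]

lemma quad_vec {n : ℕ} (f x : Fin n → ℝ) :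
    x ⬝ᵥ (vecMulVec f f) *ᵥ x = (f ⬝ᵥ x)^2 := by
  rw [vecMulVec_mulVec]
  simp [dotProduct_comm x f, sq]

lemma john {n : ℕ} (hn : 0 < n) (F : Set (Fin n → ℝ)) (hB : ∃ B : ℝ, ∀ f ∈ F, ∀ i, |f i| ≤ B)
    (he : ∀ i, Pi.single i 1 ∈ F) :
    ∃ Q : Matrix (Fin n) (Fin n) ℝ, Q.PosDef ∧
      (∀ x c, (∀ f ∈ F, (f ⬝ᵥ x)^2 ≤ c) → x ⬝ᵥ Q *ᵥ x ≤ c) ∧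
      ∀ f ∈ F, ∀ x, (f ⬝ᵥ x)^2 ≤ n * (x ⬝ᵥ Q *ᵥ x) := by
  obtain ⟨B, hB⟩ := hB
  have hnr : (0:ℝ) < n := by exact_mod_cast hn
  let K : Set (Matrix (Fin n) (Fin n) ℝ) := {Q | Qᵀ = Q ∧ (∀ x, 0 ≤ x ⬝ᵥ Q *ᵥ x) ∧
    ∀ x c, (∀ f ∈ F, (f ⬝ᵥ x)^2 ≤ c) → x ⬝ᵥ Q *ᵥ x ≤ c}
  have hconv : ∀ Q ∈ K, ∀ R ∈ K, ∀ s : ℝ, 0 ≤ s → s ≤ 1 → (1-s) • Q + s • R ∈ K := by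
    rintro Q ⟨q1, q2, q3⟩ R ⟨r1, r2, r3⟩ s hs0 hs1
    refine ⟨by simp [q1, r1], fun x => ?_, fun x c h => ?_⟩
    · rw [quad_smul_add]
      have := q2 x
      have := r2 x
      have : 0 ≤ 1 - s := by linarith
      positivity
    · rw [quad_smul_add]
      have := q3 x c h
      have := r3 x c h
      nlinarith
  have hf : ∀ f ∈ F, vecMulVec f f ∈ K := by
    intro f hf
    refine ⟨by rw [transpose_vecMulVec], fun x => ?_, fun x c h => ?_⟩
    · rw [quad_vec]; positivity
    · rw [quad_vec]; exact h f hf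
  have hcl : IsClosed K := by
    have hc : ∀ x : Fin n → ℝ, Continuous fun Q : Matrix (Fin n) (Fin n) ℝ => x ⬝ᵥ Q *ᵥ x := by
      intro x; fun_prop
    refine IsClosed.inter ?_ (IsClosed.inter ?_ ?_)
    · exact isClosed_eq (by fun_prop) continuous_id
    · have h : IsClosed (⋂ x : Fin n → ℝ, {Q : Matrix (Fin n) (Fin n) ℝ | 0 ≤ x ⬝ᵥ Q *ᵥ x}) :=
        isClosed_iInter fun x => isClosed_le continuous_const (hc x)
      refine (congrArg IsClosed ?_).mp h
      ext Q
      simp only [Set.mem_iInter]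
      rfl
    · have h : IsClosed (⋂ (x : Fin n → ℝ) (c : ℝ) (_ : ∀ f ∈ F, (f ⬝ᵥ x)^2 ≤ c),
          {Q : Matrix (Fin n) (Fin n) ℝ | x ⬝ᵥ Q *ᵥ x ≤ c}) :=
        isClosed_iInter fun x => isClosed_iInter fun c => isClosed_iInter fun _ =>
        isClosed_le (hc x) continuous_const
      refine (congrArg IsClosed ?_).mp h
      ext Q
      simp only [Set.mem_iInter]
      rfl
  have hent : ∀ (Q : Matrix (Fin n) (Fin n) ℝ) (i j : Fin n) (a : ℝ), Qᵀ = Q →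
      (Pi.single i 1 + Pi.single j a) ⬝ᵥ Q *ᵥ (Pi.single i 1 + Pi.single j a)
      = Q i i + 2 * a * Q i j + a^2 * Q j j := by
    intro Q i j a hQ
    have : Q j i = Q i j := congrFun (congrFun hQ i) j
    simp [mulVec_add, dotProduct_add, add_dotProduct, this, mulVec_single]
    ring
  have hcpt : IsCompact K := by
    have hc : IsCompact (Set.pi Set.univ fun _ : Fin n => Set.pi Set.univ fun _ : Fin n =>
      Set.Icc (-(B^2)) (B^2)) := isCompact_univ_pi fun _ => isCompact_univ_pi fun _ => isCompact_Icc
    refine IsCompact.of_isClosed_subset hc hcl ?_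
    rintro Q ⟨q1, q2, q3⟩ i _ j _
    have hd : ∀ i, Q i i ≤ B^2 := by
      intro i
      have := q3 (Pi.single i 1) (B^2) (fun f hf => by
        simp
        have := hB f hf i
        exact sq_le_sq.mpr (this.trans (le_abs_self B)))
      simpa using this
    have h1 := q2 (Pi.single i 1 + Pi.single j 1)
    have h2 := q2 (Pi.single i 1 + Pi.single j (-1))
    rw [hent Q i j _ q1] at h1 h2
    have := hd i
    have := hd j
    constructor <;> linarith
  -- a positive definite element
  have hI : ((1:ℝ)/n) • (1 : Matrix (Fin n) (Fin n) ℝ) ∈ K := by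
    refine ⟨by simp, fun x => ?_, fun x c h => ?_⟩
    · rw [smul_mulVec, one_mulVec, dotProduct_smul]
      have : 0 ≤ x ⬝ᵥ x := by simpa using dotProduct_star_self_nonneg x
      simp only [smul_eq_mul]; positivity
    · rw [smul_mulVec, one_mulVec, dotProduct_smul]
      have : x ⬝ᵥ x ≤ n * c := by
        calc x ⬝ᵥ x = ∑ i, x i ^ 2 := by simp [dotProduct, sq]
          _ ≤ ∑ i : Fin n, c := Finset.sum_le_sum fun i _ => by simpa using h _ (he i)
          _ = n * c := by simp
      simp only [smul_eq_mul]
      rw [one_div, inv_mul_le_iff₀ hnr]; exact this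
  obtain ⟨Q, hQ, hmax⟩ := hcpt.exists_isMaxOn ⟨_, hI⟩ (f := fun Q => Q.det) (by fun_prop)
  have hdet : 0 < Q.det := by
    have := hmax hI
    refine lt_of_lt_of_le ?_ this
    simp only [det_smul, det_one]; positivity
  have hpsd : Q.PosSemidef := posSemidef_iff_dotProduct_mulVec.mpr
    ⟨by simpa [IsHermitian] using hQ.1, by simpa using hQ.2.1⟩
  have hu : IsUnit Q.det := hdet.ne'.isUnit
  have hpd : Q.PosDef := hpsd.posDef_iff_isUnit.mpr ((isUnit_iff_isUnit_det Q).mpr hu)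
  refine ⟨Q, hpd, hQ.2.2, fun f hfF x => ?_⟩
  by_contra! hlt
  set y := Q⁻¹ *ᵥ f with hy
  set g := f ⬝ᵥ y with hg
  have hQy : Q *ᵥ y = f := by rw [hy, mulVec_mulVec, mul_nonsing_inv _ hu, one_mulVec]
  have hgn : (n:ℝ) < g := by
    by_contra! hgn
    have h0 := hQ.2.1 (x - (f ⬝ᵥ x / n) • y)
    have e1 : y ⬝ᵥ Q *ᵥ x = f ⬝ᵥ x := by
      rw [dotProduct_mulVec, ← mulVec_transpose, hQ.1, hQy]
    have e2 : x ⬝ᵥ f = f ⬝ᵥ x := dotProduct_comm _ _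
    have e3 : y ⬝ᵥ f = g := dotProduct_comm _ _
    simp only [mulVec_sub, mulVec_smul, dotProduct_sub, sub_dotProduct, smul_dotProduct, dotProduct_smul,
      hQy, e1, e2, e3, smul_eq_mul] at h0
    set p := f ⬝ᵥ x
    set q := x ⬝ᵥ Q *ᵥ x
    have h1 : (p/n)^2 * g ≤ (p/n)^2 * n := by gcongr
    have h2 : (p/n)^2 * n = p^2/n := by field_simp
    have h3 : p/n * p = p^2/n := by ring
    have h4 : q < p^2/n := by rw [lt_div_iff₀ hnr]; linarith
    nlinarith
  have key : ∀ s : ℝ, 0 < s → s < 1 → (1-s)^(n-1) * (1 - s + s * g) ≤ 1 := by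
    intro s h0 h1
    have h2 := hmax (hconv Q hQ _ (hf f hfF) s h0.le h1.le)
    have hs : (1 - s) ≠ 0 := by linarith
    have e : (1-s) • Q + s • vecMulVec f f =
      (1-s) • (Q + replicateCol Unit ((s/(1-s)) • f) * replicateRow Unit f) := by
      rw [← vecMulVec_eq, smul_add, smul_vecMulVec, smul_smul, mul_div_cancel₀ _ hs]
    simp only [Set.mem_ofPred_eq] at h2
    rw [e, det_smul, det_add_replicateCol_mul_replicateRow hu] at h2
    have e2 : (1 + replicateRow Unit f * Q⁻¹ * replicateCol Unit ((s/(1-s)) • f)).det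
        = 1 + s/(1-s) * g := by
      rw [det_unique, Matrix.mul_assoc, ← replicateCol_mulVec, mulVec_smul, Matrix.add_apply,
        replicateRow_mul_replicateCol_apply, dotProduct_smul]
      simp [hg, hy]
    rw [e2, Fintype.card_fin] at h2
    have h3 : (1-s)^n * (1 + s/(1-s)*g) ≤ 1 := by
      by_contra! hh
      nlinarith
    have h4 : (1-s)^n = (1-s)^(n-1) * (1-s) := by
      rw [← pow_succ]; congr 1; omega
    rw [h4] at h3
    calc _ = (1-s)^(n-1) * (1-s) * (1 + s/(1-s)*g) := by field_simp
      _ ≤ 1 := h3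
  have hn1 : (1:ℝ) ≤ n := by exact_mod_cast hn
  have hgp : 0 < g := by linarith
  set s := (g - n) / (2 * n * g) with hs
  have hs0 : 0 < s := div_pos (by linarith) (by positivity)
  have hs1 : s < 1 := by
    rw [hs, div_lt_one (by positivity)]; nlinarith
  have hk := key s hs0 hs1
  have hb : 1 + ((n-1:ℕ):ℝ) * (-s) ≤ (1 + (-s))^(n-1) := one_add_mul_le_pow (by linarith) _
  rw [Nat.cast_sub hn] at hb
  push_cast at hb
  have hpos : 0 < 1 - s + s * g := by nlinarith
  have h5 : (1 + ((n:ℝ)-1) * (-s)) * (1 - s + s*g) ≤ 1 :=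
    (mul_le_mul_of_nonneg_right (by simpa [sub_eq_add_neg] using hb) hpos.le).trans hk
  have h6 : s * (g - n) ≤ s * (s * ((n-1)*(g-1))) := by nlinarith
  have h7 := le_of_mul_le_mul_left h6 hs0
  have h8 : s * (2 * n * g) = g - n := by rw [hs]; field_simp
  have h9 : s * ((n-1)*(g-1)) < s * (2*n*g) := by
    apply mul_lt_mul_of_pos_left _ hs0
    nlinarith
  linarith

lemma final {n m N : ℕ} (hN : 0 < N) (A : Fin m → Matrix (Fin n) (Fin n) ℝ)
    (R : Fin N → Matrix (Fin n) (Fin n) ℝ) (hR : ∀ w, (R w).PosDef)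
    (hc : ∀ x : Fin n → ℝ, x ≠ 0 → ∀ i w, ∃ w',
      (A i *ᵥ x) ⬝ᵥ R w *ᵥ (A i *ᵥ x) < x ⬝ᵥ R w' *ᵥ x) :
    ∃ (P : Matrix (Fin n) (Fin n) (Polynomial ℝ)),
      P.IsSymm ∧
      (∀ i j, (P i j).natDegree ≤ 2 * N - 3) ∧
      (∀ t ∈ Set.Icc (-1 : ℝ) 1, (P.map (Polynomial.eval t)).PosSemidef) ∧
      (∀ x : Fin n → ℝ,
        (∀ t ∈ Set.Icc (-1 : ℝ) 1, (P.map (Polynomial.eval t)).mulVec x = 0) → x = 0) ∧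
      (∀ x : Fin n → ℝ, x ≠ 0 → ∀ i : Fin m,
        geNorm P ((A i).mulVec x) < geNorm P x) := by
  obtain ⟨u, hu1, hu2, hu3, hu4⟩ := interp N hN
  let P : Matrix (Fin n) (Fin n) ℝ[X] := Matrix.of fun a b => ∑ w, u w * C (R w a b)
  have hPe : ∀ t : ℝ, P.map (eval t) = ∑ w, (u w).eval t • R w := by
    intro t
    ext a b
    simp [P, eval_finsetSum, Matrix.sum_apply]
  have hq : ∀ (t : ℝ) (x : Fin n → ℝ), x ⬝ᵥ (P.map (eval t)) *ᵥ x =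
      ∑ w, (u w).eval t * (x ⬝ᵥ R w *ᵥ x) := by
    intro t x
    rw [hPe, sum_mulVec, dotProduct_sum]
    simp [smul_mulVec]
  have hRnn : ∀ w x, 0 ≤ x ⬝ᵥ R w *ᵥ x := fun w x => by
    simpa using (hR w).posSemidef.dotProduct_mulVec_nonneg x
  have hRpos : ∀ w x, x ≠ 0 → 0 < x ⬝ᵥ R w *ᵥ x := fun w x hx => by
    simpa using (posDef_iff_dotProduct_mulVec.mp (hR w)).2 hx
  have hlow : ∀ w, ∃ t ∈ Set.Icc (-1:ℝ) 1, ∀ x, x ⬝ᵥ R w *ᵥ x ≤ x ⬝ᵥ (P.map (eval t)) *ᵥ x := by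
    intro w
    obtain ⟨t, ht, h1⟩ := hu4 w
    refine ⟨t, ht, fun x => ?_⟩
    rw [hq]
    refine le_trans ?_ (Finset.single_le_sum (f := fun w => (u w).eval t * (x ⬝ᵥ R w *ᵥ x))
      (fun w _ => mul_nonneg (hu2 w t ht) (hRnn w x)) (Finset.mem_univ w))
    nlinarith [hRnn w x]
  have hup : ∀ x c, (∀ w, x ⬝ᵥ R w *ᵥ x ≤ c) → ∀ t ∈ Set.Icc (-1:ℝ) 1,
      x ⬝ᵥ (P.map (eval t)) *ᵥ x ≤ c := by
    intro x c h t ht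
    rw [hq]
    calc _ ≤ ∑ w, (u w).eval t * c :=
          Finset.sum_le_sum fun w _ => mul_le_mul_of_nonneg_left (h w) (hu2 w t ht)
      _ = c := by rw [← Finset.sum_mul, hu3, one_mul]
  refine ⟨P, ?_, ?_, ?_, ?_, ?_⟩
  · refine Matrix.IsSymm.ext fun a b => ?_
    have : ∀ w, R w b a = R w a b := fun w => by
      simpa using (hR w).isHermitian.apply a b
    simp [P, this]
  · intro a b
    change (∑ w, u w * C (R w a b)).natDegree ≤ _
    refine natDegree_sum_le_of_forall_le _ _ fun w _ => ?_
    exact (natDegree_mul_C_le (u w) (R w a b)).trans (hu1 w)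
  · intro t ht
    rw [hPe]
    exact posSemidef_sum _ fun w _ => (hR w).posSemidef.smul (hu2 w t ht)
  · intro x hx
    by_contra hx0
    obtain ⟨t, ht, h⟩ := hlow ⟨0, hN⟩
    have h1 := h x
    rw [hx t ht] at h1
    have := hRpos ⟨0, hN⟩ x hx0
    simp at h1
    linarith
  · intro x hx i
    have : Nonempty (Fin N) := ⟨⟨0, hN⟩⟩
    have : Nonempty (Set.Icc (-1:ℝ) 1) := ⟨⟨0, by simp⟩⟩
    obtain ⟨w1, hw1⟩ := Finite.exists_max fun w => (A i *ᵥ x) ⬝ᵥ R w *ᵥ (A i *ᵥ x)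
    obtain ⟨w2, hw2⟩ := Finite.exists_max fun w => x ⬝ᵥ R w *ᵥ x
    obtain ⟨w', hw'⟩ := hc x hx i w1
    obtain ⟨t, ht, h⟩ := hlow w'
    calc geNorm P (A i *ᵥ x) ≤ Real.sqrt ((A i *ᵥ x) ⬝ᵥ R w1 *ᵥ (A i *ᵥ x)) :=
          ciSup_le fun t => Real.sqrt_le_sqrt (hup _ _ hw1 t.1 t.2)
      _ < Real.sqrt (x ⬝ᵥ R w' *ᵥ x) := Real.sqrt_lt_sqrt (hRnn _ _) hw'
      _ ≤ Real.sqrt (x ⬝ᵥ (P.map (eval t)) *ᵥ x) := Real.sqrt_le_sqrt (h x)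
      _ ≤ geNorm P x := by
          refine le_ciSup (f := fun t : Set.Icc (-1 : ℝ) 1 =>
            Real.sqrt (x ⬝ᵥ (P.map (Polynomial.eval t.1)).mulVec x)) ?_ ⟨t, ht⟩
          refine ⟨Real.sqrt (x ⬝ᵥ R w2 *ᵥ x), ?_⟩
          rintro _ ⟨s, rfl⟩
          exact Real.sqrt_le_sqrt (hup _ _ hw2 s.1 s.2)

/-- Lyapunov matrix attached to a word. -/
def wordMat {n m : ℕ} (A : Fin m → Matrix (Fin n) (Fin n) ℝ) (Q : Matrix (Fin n) (Fin n) ℝ) :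
    List (Fin m) → Matrix (Fin n) (Fin n) ℝ
  | [] => Q
  | a :: w => Q + (A a)ᵀ * wordMat A Q w * A a

lemma wordMat_cons {n m : ℕ} (A : Fin m → Matrix (Fin n) (Fin n) ℝ) (Q : Matrix (Fin n) (Fin n) ℝ)
    (a : Fin m) (w : List (Fin m)) (x : Fin n → ℝ) :
    x ⬝ᵥ wordMat A Q (a :: w) *ᵥ x = x ⬝ᵥ Q *ᵥ x +
      (A a *ᵥ x) ⬝ᵥ wordMat A Q w *ᵥ (A a *ᵥ x) := by
  rw [wordMat, add_mulVec, dotProduct_add, ← mulVec_mulVec, ← mulVec_mulVec,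
    dotProduct_mulVec x (A a)ᵀ, vecMul_transpose]

lemma wordMat_append {n m : ℕ} (A : Fin m → Matrix (Fin n) (Fin n) ℝ)
    (Q : Matrix (Fin n) (Fin n) ℝ) (b : Fin m) (w : List (Fin m)) (x : Fin n → ℝ) :
    x ⬝ᵥ wordMat A Q (w ++ [b]) *ᵥ x = x ⬝ᵥ wordMat A Q w *ᵥ x +
      (((w ++ [b]).reverse.map A).prod *ᵥ x) ⬝ᵥ Q *ᵥ (((w ++ [b]).reverse.map A).prod *ᵥ x) := by
  induction w generalizing x with
  | nil =>
    rw [List.nil_append, wordMat_cons]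
    simp only [wordMat, List.reverse_cons, List.reverse_nil, List.nil_append, List.map_cons,
      List.map_nil, List.prod_cons, List.prod_nil, mul_one]
  | cons a w ih =>
    rw [List.cons_append, wordMat_cons, ih, wordMat_cons, List.reverse_cons, List.map_append,
      List.prod_append]
    simp only [List.map_cons, List.map_nil, List.prod_cons, List.prod_nil, mul_one]
    rw [← mulVec_mulVec]; ring

lemma wordMat_posDef {n m : ℕ} (A : Fin m → Matrix (Fin n) (Fin n) ℝ)
    (Q : Matrix (Fin n) (Fin n) ℝ) (hQ : Q.PosDef) (w : List (Fin m)) :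
    (wordMat A Q w).PosDef := by
  induction w with
  | nil => exact hQ
  | cons a w ih =>
    rw [wordMat]
    refine hQ.add_posSemidef ?_
    simpa using ih.posSemidef.conjTranspose_mul_mul_same (A a)

lemma opNorm_nonneg {n : ℕ} (M : Matrix (Fin n) (Fin n) ℝ) : 0 ≤ opNorm M := norm_nonneg _

lemma opNorm_mul {n : ℕ} (M M' : Matrix (Fin n) (Fin n) ℝ) :
    opNorm (M * M') ≤ opNorm M * opNorm M' := by
  unfold opNorm
  rw [map_mul]
  exact norm_mul_le _ _

lemma opNorm_one {n : ℕ} : opNorm (1 : Matrix (Fin n) (Fin n) ℝ) ≤ 1 := by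
  unfold opNorm
  rw [map_one]
  exact ContinuousLinearMap.norm_id_le

lemma entry_le_opNorm {n : ℕ} (M : Matrix (Fin n) (Fin n) ℝ) (i j : Fin n) :
    |M i j| ≤ opNorm M := by
  have h1 := (Matrix.toEuclideanCLM (𝕜 := ℝ) M).le_opNorm (WithLp.toLp 2 (Pi.single j (1:ℝ)))
  rw [toEuclideanCLM_toLp] at h1
  have h2 := PiLp.norm_apply_le (WithLp.toLp 2 (M *ᵥ Pi.single j (1:ℝ))) i
  simp at h1 h2
  exact h2.trans h1

lemma prod_bound {n m : ℕ} (A : Fin m → Matrix (Fin n) (Fin n) ℝ) :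
    ∃ B : ℝ, 1 ≤ B ∧ ∀ l : List (Fin m), opNorm ((l.map A).prod) ≤ B ^ l.length := by
  refine ⟨1 + ∑ i, opNorm (A i), ?_, fun l => ?_⟩
  · have : 0 ≤ ∑ i, opNorm (A i) := Finset.sum_nonneg fun i _ => opNorm_nonneg _
    linarith
  · induction l with
    | nil => simpa using opNorm_one
    | cons a l ih =>
      have h1 : opNorm (A a) ≤ ∑ i, opNorm (A i) :=
        Finset.single_le_sum (f := fun i => opNorm (A i)) (fun i _ => opNorm_nonneg _)
          (Finset.mem_univ a)
      have h0 := opNorm_nonneg (A a)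
      rw [List.map_cons, List.prod_cons, List.length_cons, pow_succ']
      exact (opNorm_mul _ _).trans (mul_le_mul (by linarith) ih (opNorm_nonneg _) (by linarith))

/-- If `lam` is strictly larger than the joint spectral radius, scaled products are bounded. -/
lemma scaled_bound {n m : ℕ} (A : Fin m → Matrix (Fin n) (Fin n) ℝ) (lam : ℝ) (h0 : 0 < lam)
    (h : Filter.limsup
        (fun k : ℕ =>
          (⨆ σ : Fin k → Fin m, opNorm ((List.ofFn fun i : Fin k => A (σ i)).prod))
            ^ ((1 : ℝ) / k))
        Filter.atTop < lam) :
    ∃ D : ℝ, ∀ l : List (Fin m), opNorm ((l.map A).prod) ≤ D * lam ^ l.length := by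
  obtain ⟨B, hB1, hB⟩ := prod_bound A
  have hofn : ∀ (k : ℕ) (σ : Fin k → Fin m),
      (List.ofFn fun i : Fin k => A (σ i)) = (List.ofFn σ).map A := by
    intro k σ; rw [List.map_ofFn]; rfl
  have hle : ∀ (k : ℕ), (⨆ σ : Fin k → Fin m, opNorm ((List.ofFn fun i : Fin k => A (σ i)).prod))
      ≤ B ^ k := by
    intro k
    refine Real.iSup_le (fun σ => ?_) (by positivity)
    rw [hofn]
    simpa using hB (List.ofFn σ)
  have hnn : ∀ (k : ℕ), 0 ≤ (⨆ σ : Fin k → Fin m,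
      opNorm ((List.ofFn fun i : Fin k => A (σ i)).prod)) :=
    fun k => Real.iSup_nonneg fun σ => opNorm_nonneg _
  have hbd : Filter.IsBoundedUnder (· ≤ ·) Filter.atTop (fun k : ℕ =>
          (⨆ σ : Fin k → Fin m, opNorm ((List.ofFn fun i : Fin k => A (σ i)).prod))
            ^ ((1 : ℝ) / k)) := by
    refine Filter.isBoundedUnder_of_eventually_le (a := B) ?_
    filter_upwards [Filter.eventually_gt_atTop 0] with k hk
    rw [one_div]
    calc _ ≤ (B^k) ^ ((k:ℝ)⁻¹) := Real.rpow_le_rpow (hnn k) (hle k) (by positivity)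
      _ = B := Real.pow_rpow_inv_natCast (by linarith) hk.ne'
  obtain ⟨K, hK⟩ := Filter.eventually_atTop.mp (Filter.eventually_lt_of_limsup_lt h hbd)
  refine ⟨1 + (max 1 (B / lam)) ^ (K + 1), fun l => ?_⟩
  have hlp : 0 < lam ^ l.length := by positivity
  have hMp : 0 < (max 1 (B / lam)) ^ (K + 1) := by positivity
  by_cases hl : K + 1 ≤ l.length
  · have h1 := hK l.length (by omega)
    have h2 : opNorm ((l.map A).prod) ≤ lam ^ l.length := by
      have h3 : opNorm ((l.map A).prod) ≤ (⨆ σ : Fin l.length → Fin m,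
          opNorm ((List.ofFn fun i : Fin l.length => A (σ i)).prod)) := by
        refine le_trans (le_of_eq ?_) (le_ciSup (Set.finite_range _).bddAbove l.get)
        rw [hofn, List.ofFn_get]
      refine h3.trans ?_
      rw [one_div] at h1
      have := pow_le_pow_left₀ (Real.rpow_nonneg (hnn _) _) h1.le l.length
      rwa [Real.rpow_inv_natCast_pow (hnn _) (by omega)] at this
    nlinarith
  · have h2 : B ^ l.length ≤ (max 1 (B / lam)) ^ (K + 1) * lam ^ l.length := by
      have : B ^ l.length = (B/lam) ^ l.length * lam ^ l.length := by
        rw [← mul_pow]; congr 1; field_simp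
      rw [this]
      gcongr
      calc (B/lam)^l.length ≤ (max 1 (B / lam)) ^ l.length := by
            gcongr; exact le_max_right _ _
        _ ≤ _ := pow_le_pow_right₀ (le_max_left _ _) (by omega)
    have := hB l
    nlinarith

lemma exists_Q {n m : ℕ} (hn : 0 < n) (A : Fin m → Matrix (Fin n) (Fin n) ℝ) (lam : ℝ)
    (h0 : 0 < lam)
    (h : ∃ D : ℝ, ∀ l : List (Fin m), opNorm ((l.map A).prod) ≤ D * lam ^ l.length) :
    ∃ Q : Matrix (Fin n) (Fin n) ℝ, Q.PosDef ∧ ∀ (l : List (Fin m)) (x : Fin n → ℝ),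
      ((l.map A).prod *ᵥ x) ⬝ᵥ Q *ᵥ ((l.map A).prod *ᵥ x) ≤
        lam ^ (2 * l.length) * n * (x ⬝ᵥ Q *ᵥ x) := by
  obtain ⟨D, hD⟩ := h
  let F : Set (Fin n → ℝ) := {f | ∃ (l : List (Fin m)) (j : Fin n),
    f = (lam⁻¹)^l.length • ((l.map A).prod j)}
  obtain ⟨Q, hQ, h1, h2⟩ := john hn F ⟨D, by
      rintro _ ⟨l, j, rfl⟩ i
      have e1 := (entry_le_opNorm ((l.map A).prod) j i).trans (hD l)
      rw [Pi.smul_apply, smul_eq_mul, abs_mul, abs_of_pos (by positivity), inv_pow,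
        inv_mul_le_iff₀ (by positivity), mul_comm]
      exact e1⟩ (by
      intro i
      refine ⟨[], i, ?_⟩
      ext j
      simp [Matrix.one_apply, Pi.single_apply, eq_comm])
  refine ⟨Q, hQ, fun l x => h1 _ _ ?_⟩
  rintro _ ⟨l', j, rfl⟩
  have h3 := h2 ((lam⁻¹)^(l' ++ l).length • (((l' ++ l).map A).prod j)) ⟨_, _, rfl⟩ x
  have e : ((l' ++ l).map A).prod j = (l'.map A).prod j ᵥ* (l.map A).prod := by
    rw [List.map_append, List.prod_append]; exact mul_apply_eq_vecMul _ _ _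
  rw [e, List.length_append, smul_dotProduct, ← dotProduct_mulVec, smul_eq_mul] at h3
  rw [smul_dotProduct, smul_eq_mul]
  set p := (l'.map A).prod j ⬝ᵥ (l.map A).prod *ᵥ x
  calc ((lam⁻¹)^l'.length * p)^2 = lam ^ (2 * l.length) * ((lam⁻¹)^(l'.length + l.length) * p)^2 := by
        rw [pow_add, inv_pow, inv_pow, mul_comm 2, pow_mul]; field_simp
    _ ≤ lam ^ (2 * l.length) * (n * (x ⬝ᵥ Q *ᵥ x)) := by gcongr
    _ = _ := by ring

/-- if the joint spectral radius of `𝒜 = {A₁, …, A_m} ⊆ ℝ^{n×n}` is less than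
`1/n^{1/(2ℓ)}`, then there is a contracting GE-`d`-norm for `𝒜` with
`d ≤ max{2m^{ℓ-1} - 3, 0}`. -/
theorem stmt_18 {n m : ℕ} (A : Fin m → Matrix (Fin n) (Fin n) ℝ) (ℓ : ℕ) (hℓ : 1 ≤ ℓ)
    (hjsr : Filter.limsup
        (fun k : ℕ =>
          (⨆ σ : Fin k → Fin m, opNorm ((List.ofFn fun i : Fin k => A (σ i)).prod))
            ^ ((1 : ℝ) / k))
        Filter.atTop < 1 / (n : ℝ) ^ ((1 : ℝ) / (2 * (ℓ : ℝ)))) :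
    ∃ (d : ℕ) (P : Matrix (Fin n) (Fin n) (Polynomial ℝ)),
      (d : ℤ) ≤ max (2 * (m : ℤ) ^ (ℓ - 1) - 3) 0 ∧
      P.IsSymm ∧
      (∀ i j, (P i j).natDegree ≤ d) ∧
      (∀ t ∈ Set.Icc (-1 : ℝ) 1, (P.map (Polynomial.eval t)).PosSemidef) ∧
      (∀ x : Fin n → ℝ,
        (∀ t ∈ Set.Icc (-1 : ℝ) 1, (P.map (Polynomial.eval t)).mulVec x = 0) → x = 0) ∧
      (∀ x : Fin n → ℝ, x ≠ 0 → ∀ i : Fin m,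
        geNorm P ((A i).mulVec x) < geNorm P x) := by
  rcases Nat.eq_zero_or_pos n with hn | hn
  · subst hn
    refine ⟨0, 0, by simp, by simp, by simp, fun t _ => ?_, fun x _ => Subsingleton.elim _ _,
      fun x hx => absurd (Subsingleton.elim _ _) hx⟩
    rw [Subsingleton.elim (Matrix.map 0 (eval t)) 0]
    exact PosSemidef.zero
  rcases Nat.eq_zero_or_pos m with hm | hm
  · subst hm
    have he : ∀ t : ℝ, (1 : Matrix (Fin n) (Fin n) ℝ[X]).map (eval t) = 1 := by
      intro t; exact Matrix.map_one _ (by simp) (by simp)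
    refine ⟨0, 1, by simp, by simp, fun i j => ?_, fun t _ => ?_, fun x hx => ?_,
      fun x hx i => i.elim0⟩
    · rw [Matrix.one_apply]; split_ifs <;> simp
    · rw [he]; exact PosSemidef.one
    · simpa [he] using hx 0 (by simp)
  have hnr : (0:ℝ) < n := by exact_mod_cast hn
  set b : ℝ := 1 / (n : ℝ) ^ ((1 : ℝ) / (2 * (ℓ : ℝ))) with hb
  have hbpos : 0 < b := by positivity
  obtain ⟨lam, hl1, hl2⟩ := exists_between (max_lt hjsr hbpos)
  have h0 : 0 < lam := (le_max_right _ _).trans_lt hl1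
  obtain ⟨Q, hQ, hQc⟩ := exists_Q hn A lam h0 (scaled_bound A lam h0 ((le_max_left _ _).trans_lt hl1))
  have hcl : lam ^ (2 * ℓ) * n < 1 := by
    have h1 : lam ^ (2*ℓ) < b ^ (2*ℓ) := pow_lt_pow_left₀ hl2 h0.le (by omega)
    have h2 : b ^ (2*ℓ) = 1 / n := by
      have : ((1 : ℝ) / (2 * (ℓ : ℝ))) = (((2*ℓ:ℕ):ℝ))⁻¹ := by push_cast; rw [one_div]
      rw [hb, div_pow, one_pow, this, Real.rpow_inv_natCast_pow hnr.le (by omega)]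
    rw [h2, lt_div_iff₀ hnr] at h1
    exact h1
  have hcard : Fintype.card (List.Vector (Fin m) (ℓ-1)) = m ^ (ℓ-1) := by
    rw [card_vector, Fintype.card_fin]
  let e := Fintype.equivFinOfCardEq hcard
  have hN : 0 < m ^ (ℓ-1) := by positivity
  obtain ⟨P, p1, p2, p3, p4, p5⟩ := final hN A (fun w => wordMat A Q (e.symm w).1)
    (fun w => wordMat_posDef A Q hQ _) (by
      intro x hx i w
      have hlen : (e.symm w).1.length = ℓ - 1 := (e.symm w).2
      set v := (e.symm w).1
      have hne : i :: v ≠ [] := by simp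
      have hsplit := List.dropLast_append_getLast hne
      set w' := (i :: v).dropLast with hw'
      set bl := (i :: v).getLast hne
      have hlen' : w'.length = ℓ - 1 := by simp [hw', hlen]
      let w'' : List.Vector (Fin m) (ℓ-1) := ⟨w', hlen'⟩
      refine ⟨e w'', ?_⟩
      rw [Equiv.symm_apply_apply]
      change _ < x ⬝ᵥ wordMat A Q w' *ᵥ x
      have e1 := wordMat_cons A Q i v x
      have e2 := wordMat_append A Q bl w' x
      have e3 := hQc (w' ++ [bl]).reverse x
      rw [hsplit] at e2 e3
      have hl : (i :: v).reverse.length = ℓ := by simp [hlen]; omega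
      rw [hl] at e3
      have hp : 0 < x ⬝ᵥ Q *ᵥ x := by
        simpa using (posDef_iff_dotProduct_mulVec.mp hQ).2 hx
      have : lam ^ (2 * ℓ) * n * (x ⬝ᵥ Q *ᵥ x) < x ⬝ᵥ Q *ᵥ x := by nlinarith
      linarith)
  refine ⟨2 * m^(ℓ-1) - 3, P, ?_, p1, p2, p3, p4, p5⟩
  have : ((m ^ (ℓ-1) : ℕ) : ℤ) = (m:ℤ)^(ℓ-1) := by push_cast; rfl
  rw [← this]
  omega
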